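/- Contraction admissibility for LS_BBI: if Γ; Γ ⊢ Δ; Δ is derivable in LS_BBI, then Γ ⊢ Δ is derivable in LS_BBI with the same height. In particular, contraction on relational atoms is admissible: a derivation of (x,y ▷ z); (x,y ▷ z); Γ ⊢ Δ of height n yields a derivation of (x,y ▷ z); Γ ⊢ Δ of height at most n. -/

import Mathlib

/-- BBI formulas. -/
inductive BBIForm where
  | atom : ℕ → BBIForm
  | top : BBIForm
  | bot : BBIForm
  | emp : BBIForm               -- ⊤*
  | neg : BBIForm → BBIForm
  | conj : BBIForm → BBIForm → BBIForm
  | disj : BBIForm → BBIForm → BBIForm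
  | imp : BBIForm → BBIForm → BBIForm
  | star : BBIForm → BBIForm → BBIForm
  | wand : BBIForm → BBIForm → BBIForm
deriving DecidableEq

/-- Labels: the constant ε together with label variables. -/
inductive Label where
  | eps : Label
  | var : ℕ → Label
deriving DecidableEq

/-- A labelled formula w : A. -/
abbrev LForm := Label × BBIForm

/-- A relational atom (x, y ▷ z). -/
abbrev RAtom := Label × Label × Label

/-- An element of the antecedent: a relational atom or a labelled formula. -/
abbrev LElem := RAtom ⊕ LForm

/-- Substitution [y/x] on a single label. -/
def lsub (x y w : Label) : Label := if w = x then y else w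

/-- Substitution [y/x] on an antecedent element. -/
def substElem (x y : Label) : LElem → LElem
  | Sum.inl (a, b, c) => Sum.inl (lsub x y a, lsub x y b, lsub x y c)
  | Sum.inr (a, A) => Sum.inr (lsub x y a, A)

/-- Substitution [y/x] on an antecedent. -/
def substL (x y : Label) (Γ : Multiset LElem) : Multiset LElem :=
  Γ.map (substElem x y)

/-- Substitution [y/x] on a succedent. -/
def substR (x y : Label) (Δ : Multiset LForm) : Multiset LForm :=
  Δ.map (fun f => (lsub x y f.1, f.2))

/-- The labels occurring in an antecedent element. -/
def labelsOf : LElem → List Label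
  | Sum.inl (a, b, c) => [a, b, c]
  | Sum.inr (a, _) => [a]

/-- A label is fresh for (does not occur in) a sequent. -/
def freshIn (w : Label) (Γ : Multiset LElem) (Δ : Multiset LForm) : Prop :=
  (∀ e ∈ Γ, w ∉ labelsOf e) ∧ (∀ f ∈ Δ, w ≠ f.1)

/-- Shorthand for a relational atom in the antecedent. -/
def ra (x y z : Label) : LElem := Sum.inl (x, y, z)

/-- Shorthand for a labelled formula in the antecedent. -/
def lf (w : Label) (A : BBIForm) : LElem := Sum.inr (w, A)

/-- Derivability in the labelled sequent calculus LS_BBI for Boolean BI,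
indexed by a flag allowing the cut rule, the sequent, and the height of the
derivation.  `Deriv false Γ Δ n` is derivability in the cut-free calculus
(rules id, ⊥L, ⊤R, ⊤*L, ⊤*R, ∧L, ∧R, →L, →R, ∗L, ∗R, −∗L, −∗R and the
structural rules E, A, U, A_C, Eq1, Eq2); `Deriv true Γ Δ n` additionally
allows cut. -/
inductive Deriv : Bool → Multiset LElem → Multiset LForm → ℕ → Prop where
  | id (c : Bool) (Γ : Multiset LElem) (Δ : Multiset LForm) (w : Label) (p : ℕ) :
      Deriv c (lf w (BBIForm.atom p) ::ₘ Γ) ((w, BBIForm.atom p) ::ₘ Δ) 1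
  | botL (c : Bool) (Γ : Multiset LElem) (Δ : Multiset LForm) (w : Label) :
      Deriv c (lf w BBIForm.bot ::ₘ Γ) Δ 1
  | topR (c : Bool) (Γ : Multiset LElem) (Δ : Multiset LForm) (w : Label) :
      Deriv c Γ ((w, BBIForm.top) ::ₘ Δ) 1
  | empR (c : Bool) (Γ : Multiset LElem) (Δ : Multiset LForm) :
      Deriv c Γ ((Label.eps, BBIForm.emp) ::ₘ Δ) 1
  | empL {c Γ Δ n} (w : Label) : w ≠ Label.eps →
      Deriv c (substL w Label.eps Γ) (substR w Label.eps Δ) n →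
      Deriv c (lf w BBIForm.emp ::ₘ Γ) Δ (n + 1)
  | conjL {c Γ Δ n} (w : Label) (A B : BBIForm) :
      Deriv c (lf w A ::ₘ lf w B ::ₘ Γ) Δ n →
      Deriv c (lf w (BBIForm.conj A B) ::ₘ Γ) Δ (n + 1)
  | conjR {c Γ Δ n m} (w : Label) (A B : BBIForm) :
      Deriv c Γ ((w, A) ::ₘ Δ) n →
      Deriv c Γ ((w, B) ::ₘ Δ) m →
      Deriv c Γ ((w, BBIForm.conj A B) ::ₘ Δ) (max n m + 1)
  | impL {c Γ Δ n m} (w : Label) (A B : BBIForm) :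
      Deriv c Γ ((w, A) ::ₘ Δ) n →
      Deriv c (lf w B ::ₘ Γ) Δ m →
      Deriv c (lf w (BBIForm.imp A B) ::ₘ Γ) Δ (max n m + 1)
  | impR {c Γ Δ n} (w : Label) (A B : BBIForm) :
      Deriv c (lf w A ::ₘ Γ) ((w, B) ::ₘ Δ) n →
      Deriv c Γ ((w, BBIForm.imp A B) ::ₘ Δ) (n + 1)
  | starL {c Γ Δ n} (x y z : Label) (A B : BBIForm) :
      x ≠ Label.eps → y ≠ Label.eps → x ≠ y →
      freshIn x (lf z (BBIForm.star A B) ::ₘ Γ) Δ →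
      freshIn y (lf z (BBIForm.star A B) ::ₘ Γ) Δ →
      Deriv c (ra x y z ::ₘ lf x A ::ₘ lf y B ::ₘ Γ) Δ n →
      Deriv c (lf z (BBIForm.star A B) ::ₘ Γ) Δ (n + 1)
  | starR {c Γ Δ n m} (x y z : Label) (A B : BBIForm) :
      Deriv c (ra x y z ::ₘ Γ) ((x, A) ::ₘ (z, BBIForm.star A B) ::ₘ Δ) n →
      Deriv c (ra x y z ::ₘ Γ) ((y, B) ::ₘ (z, BBIForm.star A B) ::ₘ Δ) m →
      Deriv c (ra x y z ::ₘ Γ) ((z, BBIForm.star A B) ::ₘ Δ) (max n m + 1)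
  | wandL {c Γ Δ n m} (x y z : Label) (A B : BBIForm) :
      Deriv c (ra x y z ::ₘ lf y (BBIForm.wand A B) ::ₘ Γ) ((x, A) ::ₘ Δ) n →
      Deriv c (ra x y z ::ₘ lf y (BBIForm.wand A B) ::ₘ lf z B ::ₘ Γ) Δ m →
      Deriv c (ra x y z ::ₘ lf y (BBIForm.wand A B) ::ₘ Γ) Δ (max n m + 1)
  | wandR {c Γ Δ n} (x y z : Label) (A B : BBIForm) :
      x ≠ Label.eps → z ≠ Label.eps → x ≠ z →
      freshIn x Γ ((y, BBIForm.wand A B) ::ₘ Δ) →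
      freshIn z Γ ((y, BBIForm.wand A B) ::ₘ Δ) →
      Deriv c (ra x y z ::ₘ lf x A ::ₘ Γ) ((z, B) ::ₘ Δ) n →
      Deriv c Γ ((y, BBIForm.wand A B) ::ₘ Δ) (n + 1)
  | exch {c Γ Δ n} (x y z : Label) :
      Deriv c (ra y x z ::ₘ ra x y z ::ₘ Γ) Δ n →
      Deriv c (ra x y z ::ₘ Γ) Δ (n + 1)
  | assoc {c Γ Δ n} (x y z u v w : Label) :
      w ≠ Label.eps →
      freshIn w (ra x y z ::ₘ ra u v x ::ₘ Γ) Δ →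
      Deriv c (ra u w z ::ₘ ra y v w ::ₘ ra x y z ::ₘ ra u v x ::ₘ Γ) Δ n →
      Deriv c (ra x y z ::ₘ ra u v x ::ₘ Γ) Δ (n + 1)
  | unit {c Γ Δ n} (x : Label) :
      Deriv c (ra x Label.eps x ::ₘ Γ) Δ n →
      Deriv c Γ Δ (n + 1)
  | assocC {c Γ Δ n} (x y w : Label) :
      w ≠ Label.eps →
      freshIn w (ra x y x ::ₘ Γ) Δ →
      Deriv c (ra x w x ::ₘ ra y y w ::ₘ ra x y x ::ₘ Γ) Δ n →
      Deriv c (ra x y x ::ₘ Γ) Δ (n + 1)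
  | eq1 {c Γ Δ n} (w w' : Label) :
      w ≠ Label.eps →
      Deriv c (ra Label.eps w' w' ::ₘ substL w w' Γ) (substR w w' Δ) n →
      Deriv c (ra Label.eps w w' ::ₘ Γ) Δ (n + 1)
  | eq2 {c Γ Δ n} (w w' : Label) :
      w ≠ Label.eps →
      Deriv c (ra Label.eps w' w' ::ₘ substL w w' Γ) (substR w w' Δ) n →
      Deriv c (ra Label.eps w' w ::ₘ Γ) Δ (n + 1)
  | cut {Γ Γ' Δ Δ' n m} (x : Label) (A : BBIForm) :
      Deriv true Γ ((x, A) ::ₘ Δ) n →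
      Deriv true (lf x A ::ₘ Γ') Δ' m →
      Deriv true (Γ + Γ') (Δ + Δ') (max n m + 1)

/-- Relabelling of an antecedent element. -/
def mapE (σ : Label → Label) : LElem → LElem
  | Sum.inl (a, b, c) => Sum.inl (σ a, σ b, σ c)
  | Sum.inr (a, A) => Sum.inr (σ a, A)

/-- `cov Γ Δ A s w`: the labelled formula `w : A` on side `s` (`true` = left) is covered by
the sequent `Γ ⊢ Δ`: it occurs there, or its components under an invertible rule are covered. -/
def cov (Γ : Multiset LElem) (Δ : Multiset LForm) : BBIForm → Bool → Label → Prop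
  | .emp, true, w => lf w .emp ∈ Γ ∨ w = Label.eps
  | .conj A B, true, w => lf w (.conj A B) ∈ Γ ∨ (cov Γ Δ A true w ∧ cov Γ Δ B true w)
  | .conj A B, false, w => (w, BBIForm.conj A B) ∈ Δ ∨ (cov Γ Δ A false w ∨ cov Γ Δ B false w)
  | .imp A B, true, w => lf w (.imp A B) ∈ Γ ∨ (cov Γ Δ A false w ∨ cov Γ Δ B true w)
  | .imp A B, false, w => (w, BBIForm.imp A B) ∈ Δ ∨ (cov Γ Δ A true w ∧ cov Γ Δ B false w)
  | .star A B, true, z => lf z (.star A B) ∈ Γ ∨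
      ∃ x y, ra x y z ∈ Γ ∧ cov Γ Δ A true x ∧ cov Γ Δ B true y
  | .wand A B, false, y => (y, BBIForm.wand A B) ∈ Δ ∨
      ∃ x z, ra x y z ∈ Γ ∧ cov Γ Δ A true x ∧ cov Γ Δ B false z
  | A, true, w => lf w A ∈ Γ
  | A, false, w => (w, A) ∈ Δ

def covE (Γ : Multiset LElem) (Δ : Multiset LForm) : LElem → Prop
  | Sum.inl r => Sum.inl r ∈ Γ
  | Sum.inr (w, A) => cov Γ Δ A true w

def CovL (Γ : Multiset LElem) (σ : Label → Label) (Γ' : Multiset LElem) (Δ' : Multiset LForm) :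
    Prop := ∀ e ∈ Γ, covE Γ' Δ' (mapE σ e)

def CovR (Δ : Multiset LForm) (σ : Label → Label) (Γ' : Multiset LElem) (Δ' : Multiset LForm) :
    Prop := ∀ f ∈ Δ, cov Γ' Δ' f.2 false (σ f.1)

theorem cov_memL {Γ Δ A w} (h : lf w A ∈ Γ) : cov Γ Δ A true w := by
  cases A <;> simp [cov, h]

theorem cov_memR {Γ : Multiset LElem} {Δ : Multiset LForm} {A w} (h : (w, A) ∈ Δ) :
    cov Γ Δ A false w := by
  cases A <;> simp [cov, h]

theorem covE_mem {Γ Δ e} (h : e ∈ Γ) : covE Γ Δ e := by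
  rcases e with r | ⟨w, A⟩
  · exact h
  · exact cov_memL h

theorem mapE_id (e : LElem) : mapE (fun x => x) e = e := by
  rcases e with ⟨a, b, c⟩ | ⟨w, A⟩ <;> rfl

theorem mapE_comp (τ σ : Label → Label) (e : LElem) : mapE τ (mapE σ e) = mapE (τ ∘ σ) e := by
  rcases e with ⟨a, b, c⟩ | ⟨w, A⟩ <;> rfl

theorem covL_ra {Γ σ Γ' Δ' x y z} (h : CovL Γ σ Γ' Δ') (hm : ra x y z ∈ Γ) :
    ra (σ x) (σ y) (σ z) ∈ Γ' := h _ hm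

theorem covL_lf {Γ σ Γ' Δ' x A} (h : CovL Γ σ Γ' Δ') (hm : lf x A ∈ Γ) :
    cov Γ' Δ' A true (σ x) := h _ hm

theorem cov_trans {Γ Δ τ Γ' Δ'} (hL : CovL Γ τ Γ' Δ') (hR : CovR Δ τ Γ' Δ')
    (hτ : τ Label.eps = Label.eps) (A : BBIForm) :
    ∀ (s : Bool) (w : Label), cov Γ Δ A s w → cov Γ' Δ' A s (τ w) := by
  have hL' : ∀ {w A}, lf w A ∈ Γ → cov Γ' Δ' A true (τ w) := fun h => covL_lf hL h
  have hR' : ∀ {w A}, (w, A) ∈ Δ → cov Γ' Δ' A false (τ w) := fun h => hR _ h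
  induction A with
  | atom p => intro s w h; cases s; exacts [hR' h, hL' h]
  | top => intro s w h; cases s; exacts [hR' h, hL' h]
  | bot => intro s w h; cases s; exacts [hR' h, hL' h]
  | neg A _ => intro s w h; cases s; exacts [hR' h, hL' h]
  | disj A B _ _ => intro s w h; cases s; exacts [hR' h, hL' h]
  | emp =>
    intro s w h
    cases s
    · exact hR' h
    · rcases h with h | h
      · exact hL' h
      · right; rw [h, hτ]
  | conj A B ihA ihB =>
    intro s w h
    cases s
    · rcases h with h | h | h
      · exact hR' h
      · exact Or.inr (Or.inl (ihA _ _ h))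
      · exact Or.inr (Or.inr (ihB _ _ h))
    · rcases h with h | ⟨h1, h2⟩
      · exact hL' h
      · exact Or.inr ⟨ihA _ _ h1, ihB _ _ h2⟩
  | imp A B ihA ihB =>
    intro s w h
    cases s
    · rcases h with h | ⟨h1, h2⟩
      · exact hR' h
      · exact Or.inr ⟨ihA _ _ h1, ihB _ _ h2⟩
    · rcases h with h | h | h
      · exact hL' h
      · exact Or.inr (Or.inl (ihA _ _ h))
      · exact Or.inr (Or.inr (ihB _ _ h))
  | star A B ihA ihB =>
    intro s w h
    cases s
    · exact hR' h
    · rcases h with h | ⟨x, y, h0, h1, h2⟩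
      · exact hL' h
      · exact Or.inr ⟨τ x, τ y, covL_ra hL h0, ihA _ _ h1, ihB _ _ h2⟩
  | wand A B ihA ihB =>
    intro s w h
    cases s
    · rcases h with h | ⟨x, y, h0, h1, h2⟩
      · exact hR' h
      · exact Or.inr ⟨τ x, τ y, covL_ra hL h0, ihA _ _ h1, ihB _ _ h2⟩
    · exact hL' h

theorem covL_trans {Γ₀ σ Γ Δ τ Γ' Δ'} (h : CovL Γ₀ σ Γ Δ) (hL : CovL Γ τ Γ' Δ')
    (hR : CovR Δ τ Γ' Δ') (hτ : τ Label.eps = Label.eps) : CovL Γ₀ (τ ∘ σ) Γ' Δ' := by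
  intro e he
  have := h e he
  rcases e with ⟨a, b, c⟩ | ⟨w, A⟩
  · exact covL_ra (x := σ a) (y := σ b) (z := σ c) hL this
  · exact cov_trans hL hR hτ A _ _ this

theorem covR_trans {Δ₀ σ Γ Δ τ Γ' Δ'} (h : CovR Δ₀ σ Γ Δ) (hL : CovL Γ τ Γ' Δ')
    (hR : CovR Δ τ Γ' Δ') (hτ : τ Label.eps = Label.eps) : CovR Δ₀ (τ ∘ σ) Γ' Δ' := by
  intro e he
  exact cov_trans hL hR hτ _ _ _ (h e he)

theorem covL_cons {e Γ σ Γ' Δ'} :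
    CovL (e ::ₘ Γ) σ Γ' Δ' ↔ covE Γ' Δ' (mapE σ e) ∧ CovL Γ σ Γ' Δ' := by
  simp [CovL]

theorem covR_cons {f Δ σ Γ' Δ'} :
    CovR (f ::ₘ Δ) σ Γ' Δ' ↔ cov Γ' Δ' f.2 false (σ f.1) ∧ CovR Δ σ Γ' Δ' := by
  simp [CovR]

theorem covL_sub {Γ Γ' : Multiset LElem} {Δ'} (h : Γ ⊆ Γ') : CovL Γ (fun x => x) Γ' Δ' := by
  intro e he
  rw [mapE_id]
  exact covE_mem (h he)

theorem covR_sub {Δ Δ' : Multiset LForm} {Γ'} (h : Δ ⊆ Δ') : CovR Δ (fun x => x) Γ' Δ' := by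
  intro e he
  exact cov_memR (h he)

theorem substElem_eq (x y : Label) (e : LElem) : substElem x y e = mapE (lsub x y) e := by
  rcases e with ⟨a, b, c⟩ | ⟨w, A⟩ <;> rfl

/-- Coverage of a substituted context by a relabelling insensitive to the substitution. -/
theorem covL_subst {Γ σ x y Γ' Δ'} (hs : σ x = σ y) (h : CovL Γ σ Γ' Δ') :
    CovL (substL x y Γ) σ Γ' Δ' := by
  intro e he
  obtain ⟨e', he', rfl⟩ := Multiset.mem_map.1 he
  rw [substElem_eq, mapE_comp]
  have : σ ∘ lsub x y = σ := by
    funext a; simp only [Function.comp, lsub]; split_ifs with h1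
    · rw [h1, hs]
    · rfl
  rw [this]; exact h _ he'

theorem covR_subst {Δ σ x y Γ' Δ'} (hs : σ x = σ y) (h : CovR Δ σ Γ' Δ') :
    CovR (substR x y Δ) σ Γ' Δ' := by
  intro e he
  obtain ⟨e', he', rfl⟩ := Multiset.mem_map.1 he
  have : σ (lsub x y e'.1) = σ e'.1 := by
    simp only [lsub]; split_ifs with h1
    · rw [h1, hs]
    · rfl
  change cov _ _ e'.2 false (σ (lsub x y e'.1))
  rw [this]; exact h _ he'

theorem covL_self_subst {Γ x y} {Γ' : Multiset LElem} {Δ'} (h : substL x y Γ ⊆ Γ') :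
    CovL Γ (lsub x y) Γ' Δ' := by
  intro e he
  rw [← substElem_eq]
  exact covE_mem (h (Multiset.mem_map_of_mem _ he))

theorem covR_self_subst {Δ x y Γ'} :
    CovR Δ (lsub x y) Γ' (substR x y Δ) := by
  intro e he
  exact cov_memR (Multiset.mem_map_of_mem (fun f : LForm => (lsub x y f.1, f.2)) he)

theorem mapE_congr {σ τ : Label → Label} {e : LElem} (h : ∀ a ∈ labelsOf e, σ a = τ a) :
    mapE σ e = mapE τ e := by
  rcases e with ⟨a, b, c⟩ | ⟨w, A⟩ <;> simp_all [mapE, labelsOf]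

theorem covL_congr {Γ σ τ Γ' Δ'} (h : CovL Γ σ Γ' Δ')
    (hc : ∀ e ∈ Γ, ∀ a ∈ labelsOf e, τ a = σ a) : CovL Γ τ Γ' Δ' := by
  intro e he
  rw [mapE_congr (hc e he)]; exact h e he

theorem covR_congr {Δ σ τ Γ' Δ'} (h : CovR Δ σ Γ' Δ')
    (hc : ∀ f ∈ Δ, τ f.1 = σ f.1) : CovR Δ τ Γ' Δ' := by
  intro e he
  rw [hc e he]; exact h e he

/-- Update at a fresh label. -/
theorem covL_upd {Γ Δ σ Γ' Δ' x} (v : Label) (h : CovL Γ σ Γ' Δ') (hf : freshIn x Γ Δ) :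
    CovL Γ (Function.update σ x v) Γ' Δ' := by
  refine covL_congr h fun e he a ha => Function.update_of_ne ?_ _ _
  rintro rfl; exact hf.1 e he ha

theorem covR_upd {Γ Δ σ Γ' Δ' x} (v : Label) (h : CovR Δ σ Γ' Δ') (hf : freshIn x Γ Δ) :
    CovR Δ (Function.update σ x v) Γ' Δ' := by
  refine covR_congr h fun e he => Function.update_of_ne ?_ _ _
  intro h'; exact hf.2 e he h'.symm

theorem fresh_cons {w e Γ Δ} (h : freshIn w (e ::ₘ Γ) Δ) : w ∉ labelsOf e ∧ freshIn w Γ Δ :=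
  ⟨h.1 e (Multiset.mem_cons_self _ _), fun e' he => h.1 e' (Multiset.mem_cons_of_mem he), h.2⟩

theorem fresh_consR {w f Γ Δ} (h : freshIn w Γ (f ::ₘ Δ)) : w ≠ f.1 ∧ freshIn w Γ Δ :=
  ⟨h.2 f (Multiset.mem_cons_self _ _), h.1, fun e' he => h.2 e' (Multiset.mem_cons_of_mem he)⟩

theorem label_bound (a : Label) : ∃ N, ∀ k ≥ N, Label.var k ≠ a := by
  rcases a with _ | j
  · exact ⟨0, by simp⟩
  · refine ⟨j + 1, fun k hk h => ?_⟩
    injection h with h; omega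

theorem exists_fresh (Γ : Multiset LElem) (Δ : Multiset LForm) :
    ∃ N, ∀ k ≥ N, freshIn (Label.var k) Γ Δ := by
  have h1 : ∃ N, ∀ k ≥ N, ∀ e ∈ Γ, Label.var k ∉ labelsOf e := by
    induction Γ using Multiset.induction_on with
    | empty => exact ⟨0, by simp⟩
    | cons e Γ ih =>
      obtain ⟨N, hN⟩ := ih
      have he : ∃ M, ∀ k ≥ M, Label.var k ∉ labelsOf e := by
        rcases e with ⟨a, b, c⟩ | ⟨w, A⟩
        · obtain ⟨p, hp⟩ := label_bound a
          obtain ⟨q, hq⟩ := label_bound b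
          obtain ⟨r, hr⟩ := label_bound c
          refine ⟨p + q + r, fun k hk => ?_⟩
          simp only [labelsOf, List.mem_cons, List.not_mem_nil, or_false, not_or]
          exact ⟨hp k (by omega), hq k (by omega), hr k (by omega)⟩
        · obtain ⟨p, hp⟩ := label_bound w
          exact ⟨p, fun k hk => by simpa [labelsOf] using hp k hk⟩
      obtain ⟨M, hM⟩ := he
      refine ⟨N + M, fun k hk e' he' => ?_⟩
      rcases Multiset.mem_cons.1 he' with rfl | he'
      · exact hM k (by omega)
      · exact hN k (by omega) e' he'
  have h2 : ∃ N, ∀ k ≥ N, ∀ f ∈ Δ, Label.var k ≠ f.1 := by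
    induction Δ using Multiset.induction_on with
    | empty => exact ⟨0, by simp⟩
    | cons e Δ ih =>
      obtain ⟨N, hN⟩ := ih
      obtain ⟨M, hM⟩ := label_bound e.1
      refine ⟨N + M, fun k hk e' he' => ?_⟩
      rcases Multiset.mem_cons.1 he' with rfl | he'
      · exact hM k (by omega)
      · exact hN k (by omega) e' he'
  obtain ⟨N, hN⟩ := h1
  obtain ⟨M, hM⟩ := h2
  exact ⟨N + M, fun k hk => ⟨hN k (by omega), hM k (by omega)⟩⟩

/-- Padding of axioms via the unit rule. -/
theorem pad (P : Multiset LElem → Prop) {Δ} (hP : ∀ Γ e, P Γ → P (e ::ₘ Γ))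
    (h : ∀ Γ, P Γ → Deriv false Γ Δ 1) : ∀ m, 1 ≤ m → ∀ Γ, P Γ → Deriv false Γ Δ m := by
  intro m hm
  induction m, hm using Nat.le_induction with
  | base => exact h
  | succ m _ ih => exact fun Γ hΓ => Deriv.unit Label.eps (ih _ (hP _ _ hΓ))

theorem lsub_self (x y : Label) : lsub x y x = y := by simp [lsub]

theorem lsub_eps {x y : Label} (h : x ≠ Label.eps) : lsub x y Label.eps = Label.eps := by
  simp [lsub, h.symm]

theorem lsub_target (x y : Label) : lsub x y y = y := by simp [lsub]

/-- Weakening of the covering sequent, keeping `σ`. -/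
theorem cov_mono {Γ Δ σ Γ₁ Δ₁ Γ₂ Δ₂} (hL : CovL Γ σ Γ₁ Δ₁) (hR : CovR Δ σ Γ₁ Δ₁)
    (h1 : CovL Γ₁ (fun x => x) Γ₂ Δ₂) (h2 : CovR Δ₁ (fun x => x) Γ₂ Δ₂) :
    CovL Γ σ Γ₂ Δ₂ ∧ CovR Δ σ Γ₂ Δ₂ :=
  ⟨covL_trans (σ := σ) (τ := fun x => x) hL h1 h2 rfl,
    covR_trans (σ := σ) (τ := fun x => x) hR h1 h2 rfl⟩

/-- The equality step common to both equality rules. -/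
theorem cov_eq {Γ Δ σ Γ' Δ' a b e} {w w' : Label} (hL : CovL Γ σ (e ::ₘ Γ') Δ')
    (hR : CovR Δ σ (e ::ₘ Γ') Δ') (ha : a ≠ Label.eps)
    (hw : lsub a b (σ w) = b) (hw' : lsub a b (σ w') = b)
    (he : substElem a b e = ra Label.eps b b) (hε : σ Label.eps = Label.eps) :
    CovL (ra Label.eps w' w' ::ₘ substL w w' Γ) (lsub a b ∘ σ)
      (ra Label.eps b b ::ₘ substL a b Γ') (substR a b Δ') ∧
    CovR (substR w w' Δ) (lsub a b ∘ σ)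
      (ra Label.eps b b ::ₘ substL a b Γ') (substR a b Δ') := by
  have h1 : CovL (e ::ₘ Γ') (lsub a b) (ra Label.eps b b ::ₘ substL a b Γ') (substR a b Δ') := by
    apply covL_self_subst
    rw [substL, Multiset.map_cons, he]; exact fun _ h => h
  have h2 : CovR Δ' (lsub a b) (ra Label.eps b b ::ₘ substL a b Γ') (substR a b Δ') :=
    covR_self_subst
  have hs : (lsub a b ∘ σ) w = (lsub a b ∘ σ) w' := hw.trans hw'.symm
  refine ⟨covL_cons.2 ⟨?_, covL_subst hs (covL_trans hL h1 h2 (lsub_eps ha))⟩,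
    covR_subst hs (covR_trans hR h1 h2 (lsub_eps ha))⟩
  change ra (lsub a b (σ Label.eps)) (lsub a b (σ w')) (lsub a b (σ w')) ∈ _
  rw [hε, lsub_eps ha, hw']; exact Multiset.mem_cons_self _ _

theorem master {c Γ Δ n} (h : Deriv c Γ Δ n) : c = false →
    ∀ (σ : Label → Label), σ Label.eps = Label.eps → ∀ Γ' Δ' m, n ≤ m →
    CovL Γ σ Γ' Δ' → CovR Δ σ Γ' Δ' → Deriv false Γ' Δ' m := by
  induction h with
  | id c Γ Δ w p =>
    intro _ σ hσ Γ' Δ' m hm hL hR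
    have h1 : lf (σ w) (.atom p) ∈ Γ' := (covL_cons.1 hL).1
    have h2 : (σ w, BBIForm.atom p) ∈ Δ' := (covR_cons.1 hR).1
    obtain ⟨Δ'', rfl⟩ := Multiset.exists_cons_of_mem h2
    refine pad (fun Γ => lf (σ w) (.atom p) ∈ Γ) (fun Γ e h => Multiset.mem_cons_of_mem h)
      (fun Γ h => ?_) m hm _ h1
    obtain ⟨Γ'', rfl⟩ := Multiset.exists_cons_of_mem h
    exact Deriv.id _ _ _ _ _
  | botL c Γ Δ w =>
    intro _ σ hσ Γ' Δ' m hm hL hR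
    have h1 : lf (σ w) .bot ∈ Γ' := (covL_cons.1 hL).1
    refine pad (fun Γ => lf (σ w) .bot ∈ Γ) (fun Γ e h => Multiset.mem_cons_of_mem h)
      (fun Γ h => ?_) m hm _ h1
    obtain ⟨Γ'', rfl⟩ := Multiset.exists_cons_of_mem h
    exact Deriv.botL _ _ _ _
  | topR c Γ Δ w =>
    intro _ σ hσ Γ' Δ' m hm hL hR
    have h2 : (σ w, BBIForm.top) ∈ Δ' := (covR_cons.1 hR).1
    obtain ⟨Δ'', rfl⟩ := Multiset.exists_cons_of_mem h2
    exact pad (fun Γ => True) (fun _ _ _ => trivial) (fun Γ _ => Deriv.topR _ _ _ _) m hm _ trivial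
  | empR c Γ Δ =>
    intro _ σ hσ Γ' Δ' m hm hL hR
    have h2 : (σ Label.eps, BBIForm.emp) ∈ Δ' := (covR_cons.1 hR).1
    rw [hσ] at h2
    obtain ⟨Δ'', rfl⟩ := Multiset.exists_cons_of_mem h2
    exact pad (fun Γ => True) (fun _ _ _ => trivial) (fun Γ _ => Deriv.empR _ _ _) m hm _ trivial
  | @empL c Γ Δ n w hw _ ih =>
    intro hc σ hσ Γ' Δ' m hm hL hR
    obtain ⟨h1, hL⟩ := covL_cons.1 hL
    by_cases hs : σ w = Label.eps
    · exact ih hc σ hσ Γ' Δ' m (by omega) (covL_subst (hs.trans hσ.symm) hL)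
        (covR_subst (hs.trans hσ.symm) hR)
    · have h1 : lf (σ w) .emp ∈ Γ' := h1.resolve_right hs
      obtain ⟨Γ'', rfl⟩ := Multiset.exists_cons_of_mem h1
      obtain ⟨k, rfl⟩ : ∃ k, m = k + 1 := ⟨m - 1, by omega⟩
      refine Deriv.empL _ hs ?_
      have g1 : CovL (lf (σ w) .emp ::ₘ Γ'') (lsub (σ w) Label.eps)
          (substL (σ w) Label.eps Γ'') (substR (σ w) Label.eps Δ') := by
        refine covL_cons.2 ⟨Or.inr (lsub_self _ _), covL_self_subst fun _ h => h⟩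
      have hε := lsub_eps (y := Label.eps) hs
      have hww : (lsub (σ w) Label.eps ∘ σ) w = (lsub (σ w) Label.eps ∘ σ) Label.eps := by
        simp [lsub_self, hσ, hε]
      exact ih hc (lsub (σ w) Label.eps ∘ σ) (by simp [hσ, hε]) _ _ k (by omega)
        (covL_subst hww (covL_trans hL g1 covR_self_subst hε))
        (covR_subst hww (covR_trans hR g1 covR_self_subst hε))
  | @conjL c Γ Δ n w A B _ ih =>
    intro hc σ hσ Γ' Δ' m hm hL hR
    obtain ⟨h1, hL⟩ := covL_cons.1 hL
    rcases h1 with h1 | ⟨hA, hB⟩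
    · obtain ⟨Γ'', rfl⟩ := Multiset.exists_cons_of_mem h1
      obtain ⟨k, rfl⟩ : ∃ k, m = k + 1 := ⟨m - 1, by omega⟩
      refine Deriv.conjL _ _ _ ?_
      have gA : cov (lf (σ w) A ::ₘ lf (σ w) B ::ₘ Γ'') Δ' A true (σ w) := cov_memL (by simp)
      have gB : cov (lf (σ w) A ::ₘ lf (σ w) B ::ₘ Γ'') Δ' B true (σ w) := cov_memL (by simp)
      obtain ⟨hL, hR⟩ := cov_mono (Γ₂ := lf (σ w) A ::ₘ lf (σ w) B ::ₘ Γ'') (Δ₂ := Δ') hL hR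
        (covL_cons.2 ⟨Or.inr ⟨gA, gB⟩, covL_sub (fun _ h => by simp [h])⟩)
        (covR_sub fun _ h => h)
      exact ih hc σ hσ _ _ k (by omega) (covL_cons.2 ⟨gA, covL_cons.2 ⟨gB, hL⟩⟩) hR
    · exact ih hc σ hσ _ _ m (by omega) (covL_cons.2 ⟨hA, covL_cons.2 ⟨hB, hL⟩⟩) hR
  | @conjR c Γ Δ n n' w A B _ _ ih1 ih2 =>
    intro hc σ hσ Γ' Δ' m hm hL hR
    obtain ⟨h1, hR⟩ := covR_cons.1 hR
    rcases h1 with h1 | hA | hB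
    · obtain ⟨Δ'', rfl⟩ := Multiset.exists_cons_of_mem h1
      obtain ⟨k, rfl⟩ : ∃ k, m = k + 1 := ⟨m - 1, by omega⟩
      rw [← max_self k]
      have gA : cov Γ' ((σ w, A) ::ₘ Δ'') A false (σ w) := cov_memR (by simp)
      have gB : cov Γ' ((σ w, B) ::ₘ Δ'') B false (σ w) := cov_memR (by simp)
      refine Deriv.conjR _ _ _ ?_ ?_
      · obtain ⟨hL, hR⟩ := cov_mono (Γ₂ := Γ') (Δ₂ := (σ w, A) ::ₘ Δ'') hL hR
          (covL_sub fun _ h => h)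
          (covR_cons.2 ⟨Or.inr (Or.inl gA), covR_sub (fun _ h => by simp [h])⟩)
        exact ih1 hc σ hσ _ _ k (by omega) hL (covR_cons.2 ⟨gA, hR⟩)
      · obtain ⟨hL, hR⟩ := cov_mono (Γ₂ := Γ') (Δ₂ := (σ w, B) ::ₘ Δ'') hL hR
          (covL_sub fun _ h => h)
          (covR_cons.2 ⟨Or.inr (Or.inr gB), covR_sub (fun _ h => by simp [h])⟩)
        exact ih2 hc σ hσ _ _ k (by omega) hL (covR_cons.2 ⟨gB, hR⟩)
    · exact ih1 hc σ hσ _ _ m (by omega) hL (covR_cons.2 ⟨hA, hR⟩)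
    · exact ih2 hc σ hσ _ _ m (by omega) hL (covR_cons.2 ⟨hB, hR⟩)
  | @impL c Γ Δ n n' w A B _ _ ih1 ih2 =>
    intro hc σ hσ Γ' Δ' m hm hL hR
    obtain ⟨h1, hL⟩ := covL_cons.1 hL
    rcases h1 with h1 | hA | hB
    · obtain ⟨Γ'', rfl⟩ := Multiset.exists_cons_of_mem h1
      obtain ⟨k, rfl⟩ : ∃ k, m = k + 1 := ⟨m - 1, by omega⟩
      rw [← max_self k]
      have gA : cov Γ'' ((σ w, A) ::ₘ Δ') A false (σ w) := cov_memR (by simp)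
      have gB : cov (lf (σ w) B ::ₘ Γ'') Δ' B true (σ w) := cov_memL (by simp)
      refine Deriv.impL _ _ _ ?_ ?_
      · obtain ⟨hL, hR⟩ := cov_mono (Γ₂ := Γ'') (Δ₂ := (σ w, A) ::ₘ Δ') hL hR
          (covL_cons.2 ⟨Or.inr (Or.inl gA), covL_sub (fun _ h => h)⟩)
          (covR_sub fun _ h => by simp [h])
        exact ih1 hc σ hσ _ _ k (by omega) hL (covR_cons.2 ⟨gA, hR⟩)
      · obtain ⟨hL, hR⟩ := cov_mono (Γ₂ := lf (σ w) B ::ₘ Γ'') (Δ₂ := Δ') hL hR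
          (covL_cons.2 ⟨Or.inr (Or.inr gB), covL_sub (fun _ h => by simp [h])⟩)
          (covR_sub fun _ h => h)
        exact ih2 hc σ hσ _ _ k (by omega) (covL_cons.2 ⟨gB, hL⟩) hR
    · exact ih1 hc σ hσ _ _ m (by omega) hL (covR_cons.2 ⟨hA, hR⟩)
    · exact ih2 hc σ hσ _ _ m (by omega) (covL_cons.2 ⟨hB, hL⟩) hR
  | @impR c Γ Δ n w A B _ ih =>
    intro hc σ hσ Γ' Δ' m hm hL hR
    obtain ⟨h1, hR⟩ := covR_cons.1 hR
    rcases h1 with h1 | ⟨hA, hB⟩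
    · obtain ⟨Δ'', rfl⟩ := Multiset.exists_cons_of_mem h1
      obtain ⟨k, rfl⟩ : ∃ k, m = k + 1 := ⟨m - 1, by omega⟩
      have gA : cov (lf (σ w) A ::ₘ Γ') ((σ w, B) ::ₘ Δ'') A true (σ w) := cov_memL (by simp)
      have gB : cov (lf (σ w) A ::ₘ Γ') ((σ w, B) ::ₘ Δ'') B false (σ w) := cov_memR (by simp)
      refine Deriv.impR _ _ _ ?_
      obtain ⟨hL, hR⟩ := cov_mono (Γ₂ := lf (σ w) A ::ₘ Γ') (Δ₂ := (σ w, B) ::ₘ Δ'') hL hR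
        (covL_sub fun _ h => by simp [h])
        (covR_cons.2 ⟨Or.inr ⟨gA, gB⟩, covR_sub (fun _ h => by simp [h])⟩)
      exact ih hc σ hσ _ _ k (by omega) (covL_cons.2 ⟨gA, hL⟩) (covR_cons.2 ⟨gB, hR⟩)
    · exact ih hc σ hσ _ _ m (by omega) (covL_cons.2 ⟨hA, hL⟩) (covR_cons.2 ⟨hB, hR⟩)
  | @starL c Γ Δ n x y z A B hx hy hxy fx fy _ ih =>
    intro hc σ hσ Γ' Δ' m hm hL hR
    obtain ⟨h1, hL⟩ := covL_cons.1 hL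
    obtain ⟨fxz, fx⟩ := fresh_cons fx
    obtain ⟨fyz, fy⟩ := fresh_cons fy
    have fxz : z ≠ x := by rintro rfl; simp [lf, labelsOf] at fxz
    have fyz : z ≠ y := by rintro rfl; simp [lf, labelsOf] at fyz
    -- the common use of the induction hypothesis
    have key : ∀ Γ₁ Δ₁ x₁ y₁ k, n ≤ k → CovL Γ σ Γ₁ Δ₁ → CovR Δ σ Γ₁ Δ₁ →
        ra x₁ y₁ (σ z) ∈ Γ₁ → cov Γ₁ Δ₁ A true x₁ → cov Γ₁ Δ₁ B true y₁ →
        Deriv false Γ₁ Δ₁ k := by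
      intro Γ₁ Δ₁ x₁ y₁ k hk hL hR h0 hA hB
      have ex : Function.update (Function.update σ x x₁) y y₁ x = x₁ := by
        simp [Function.update_of_ne hxy]
      have ey : Function.update (Function.update σ x x₁) y y₁ y = y₁ := by simp
      have ez : Function.update (Function.update σ x x₁) y y₁ z = σ z := by
        rw [Function.update_of_ne fyz, Function.update_of_ne fxz]
      refine ih hc (Function.update (Function.update σ x x₁) y y₁) ?_ _ _ k hk ?_
        (covR_upd _ (covR_upd _ hR fx) fy)
      · rw [Function.update_of_ne hy.symm, Function.update_of_ne hx.symm, hσ]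
      · refine covL_cons.2 ⟨?_, covL_cons.2 ⟨?_, covL_cons.2 ⟨?_,
          covL_upd _ (covL_upd _ hL fx) fy⟩⟩⟩
        · simpa only [ra, mapE, covE, ex, ey, ez] using h0
        · simpa only [lf, mapE, covE, ex] using hA
        · simpa only [lf, mapE, covE, ey] using hB
    rcases h1 with h1 | ⟨x₁, y₁, h0, hA, hB⟩
    · obtain ⟨N, hN⟩ := exists_fresh Γ' Δ'
      obtain ⟨Γ'', rfl⟩ := Multiset.exists_cons_of_mem h1
      obtain ⟨k, rfl⟩ : ∃ k, m = k + 1 := ⟨m - 1, by omega⟩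
      refine Deriv.starL (.var N) (.var (N + 1)) _ _ _ (by simp) (by simp) (by simp)
        (hN _ (by omega)) (hN _ (by omega)) ?_
      have g0 : ra (.var N) (.var (N + 1)) (σ z) ∈ ra (.var N) (.var (N + 1)) (σ z) ::ₘ
        lf (.var N) A ::ₘ lf (.var (N + 1)) B ::ₘ Γ'' := by simp
      have gA : cov (ra (.var N) (.var (N + 1)) (σ z) ::ₘ
        lf (.var N) A ::ₘ lf (.var (N + 1)) B ::ₘ Γ'') Δ' A true (.var N) := cov_memL (by simp)
      have gB : cov (ra (.var N) (.var (N + 1)) (σ z) ::ₘ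
        lf (.var N) A ::ₘ lf (.var (N + 1)) B ::ₘ Γ'') Δ' B true (.var (N + 1)) :=
        cov_memL (by simp)
      obtain ⟨hL, hR⟩ := cov_mono (Γ₂ := ra (.var N) (.var (N + 1)) (σ z) ::ₘ
        lf (.var N) A ::ₘ lf (.var (N + 1)) B ::ₘ Γ'') (Δ₂ := Δ') hL hR
        (covL_cons.2 ⟨Or.inr ⟨_, _, g0, gA, gB⟩, covL_sub (fun _ h => by simp [h])⟩)
        (covR_sub fun _ h => h)
      exact key _ _ _ _ k (by omega) hL hR g0 gA gB
    · exact key _ _ _ _ m (by omega) hL hR h0 hA hB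
  | @starR c Γ Δ n n' x y z A B _ _ ih1 ih2 =>
    intro hc σ hσ Γ' Δ' m hm hL hR
    have h0 : ra (σ x) (σ y) (σ z) ∈ Γ' := (covL_cons.1 hL).1
    have h1 : (σ z, BBIForm.star A B) ∈ Δ' := (covR_cons.1 hR).1
    obtain ⟨Γ'', rfl⟩ := Multiset.exists_cons_of_mem h0
    obtain ⟨Δ'', rfl⟩ := Multiset.exists_cons_of_mem h1
    obtain ⟨k, rfl⟩ : ∃ k, m = k + 1 := ⟨m - 1, by omega⟩
    rw [← max_self k]
    have mono : ∀ f, _ := fun f => cov_mono (Δ₂ := f ::ₘ (σ z, BBIForm.star A B) ::ₘ Δ'') hL hR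
      (covL_sub fun _ h => h) (covR_sub fun _ h => Multiset.mem_cons_of_mem h)
    refine Deriv.starR (σ x) (σ y) (σ z) A B ?_ ?_
    · exact ih1 hc σ hσ _ _ k (by omega) (mono _).1
        (covR_cons.2 ⟨cov_memR (Multiset.mem_cons_self _ _), (mono _).2⟩)
    · exact ih2 hc σ hσ _ _ k (by omega) (mono _).1
        (covR_cons.2 ⟨cov_memR (Multiset.mem_cons_self _ _), (mono _).2⟩)
  | @wandL c Γ Δ n n' x y z A B _ _ ih1 ih2 =>
    intro hc σ hσ Γ' Δ' m hm hL hR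
    have h0 : ra (σ x) (σ y) (σ z) ∈ Γ' := (covL_cons.1 hL).1
    have h1 : lf (σ y) (.wand A B) ∈ Γ' := (covL_cons.1 (covL_cons.1 hL).2).1
    obtain ⟨Γ₁, rfl⟩ := Multiset.exists_cons_of_mem h0
    have h1 : lf (σ y) (.wand A B) ∈ Γ₁ := by simpa [ra, lf] using h1
    obtain ⟨Γ'', rfl⟩ := Multiset.exists_cons_of_mem h1
    obtain ⟨k, rfl⟩ : ∃ k, m = k + 1 := ⟨m - 1, by omega⟩
    rw [← max_self k]
    refine Deriv.wandL (σ x) (σ y) (σ z) A B ?_ ?_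
    · obtain ⟨gL, gR⟩ := cov_mono (Δ₂ := (σ x, A) ::ₘ Δ') hL hR
        (covL_sub fun _ h => h) (covR_sub fun _ h => Multiset.mem_cons_of_mem h)
      exact ih1 hc σ hσ _ _ k (by omega) gL (covR_cons.2 ⟨cov_memR (by simp), gR⟩)
    · obtain ⟨gL, gR⟩ := cov_mono (Γ₂ := ra (σ x) (σ y) (σ z) ::ₘ lf (σ y) (.wand A B) ::ₘ
        lf (σ z) B ::ₘ Γ'') hL hR
        (covL_sub fun e h => by simp only [Multiset.mem_cons] at h ⊢; tauto)
        (covR_sub fun _ h => h)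
      obtain ⟨g1, gL⟩ := covL_cons.1 gL
      obtain ⟨g2, gL⟩ := covL_cons.1 gL
      exact ih2 hc σ hσ _ _ k (by omega)
        (covL_cons.2 ⟨g1, covL_cons.2 ⟨g2, covL_cons.2 ⟨cov_memL (by simp), gL⟩⟩⟩) gR
  | @wandR c Γ Δ n x y z A B hx hz hxz fx fz _ ih =>
    intro hc σ hσ Γ' Δ' m hm hL hR
    obtain ⟨h1, hR⟩ := covR_cons.1 hR
    obtain ⟨fxy, fx⟩ := fresh_consR fx
    obtain ⟨fzy, fz⟩ := fresh_consR fz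
    have key : ∀ Γ₁ Δ₁ x₁ z₁ k, n ≤ k → CovL Γ σ Γ₁ Δ₁ → CovR Δ σ Γ₁ Δ₁ →
        ra x₁ (σ y) z₁ ∈ Γ₁ → cov Γ₁ Δ₁ A true x₁ → cov Γ₁ Δ₁ B false z₁ →
        Deriv false Γ₁ Δ₁ k := by
      intro Γ₁ Δ₁ x₁ z₁ k hk hL hR h0 hA hB
      have ex : Function.update (Function.update σ x x₁) z z₁ x = x₁ := by
        simp [Function.update_of_ne hxz]
      have ez : Function.update (Function.update σ x x₁) z z₁ z = z₁ := by simp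
      have ey : Function.update (Function.update σ x x₁) z z₁ y = σ y := by
        rw [Function.update_of_ne fzy.symm, Function.update_of_ne fxy.symm]
      refine ih hc (Function.update (Function.update σ x x₁) z z₁) ?_ _ _ k hk ?_
        (covR_cons.2 ⟨?_, covR_upd _ (covR_upd _ hR fx) fz⟩)
      · rw [Function.update_of_ne hz.symm, Function.update_of_ne hx.symm, hσ]
      · refine covL_cons.2 ⟨?_, covL_cons.2 ⟨?_, covL_upd _ (covL_upd _ hL fx) fz⟩⟩
        · simpa only [ra, mapE, covE, ex, ey, ez] using h0
        · simpa only [lf, mapE, covE, ex] using hA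
      · simpa only [ez] using hB
    rcases h1 with h1 | ⟨x₁, y₁, h0, hA, hB⟩
    · obtain ⟨N, hN⟩ := exists_fresh Γ' Δ'
      obtain ⟨Δ'', rfl⟩ := Multiset.exists_cons_of_mem h1
      obtain ⟨k, rfl⟩ : ∃ k, m = k + 1 := ⟨m - 1, by omega⟩
      refine Deriv.wandR (.var N) _ (.var (N + 1)) _ _ (by simp) (by simp) (by simp)
        (hN _ (by omega)) (hN _ (by omega)) ?_
      have g0 : ra (.var N) (σ y) (.var (N + 1)) ∈ ra (.var N) (σ y) (.var (N + 1)) ::ₘ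
        lf (.var N) A ::ₘ Γ' := by simp
      have gA : cov (ra (.var N) (σ y) (.var (N + 1)) ::ₘ
        lf (.var N) A ::ₘ Γ') ((.var (N + 1), B) ::ₘ Δ'') A true (.var N) := cov_memL (by simp)
      have gB : cov (ra (.var N) (σ y) (.var (N + 1)) ::ₘ
        lf (.var N) A ::ₘ Γ') ((.var (N + 1), B) ::ₘ Δ'') B false (.var (N + 1)) :=
        cov_memR (by simp)
      obtain ⟨hL, hR⟩ := cov_mono (Γ₂ := ra (.var N) (σ y) (.var (N + 1)) ::ₘ
        lf (.var N) A ::ₘ Γ') (Δ₂ := (.var (N + 1), B) ::ₘ Δ'') hL hR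
        (covL_sub fun _ h => by simp [h])
        (covR_cons.2 ⟨Or.inr ⟨_, _, g0, gA, gB⟩, covR_sub (fun _ h => by simp [h])⟩)
      exact key _ _ _ _ k (by omega) hL hR g0 gA gB
    · exact key _ _ _ _ m (by omega) hL hR h0 hA hB
  | @exch c Γ Δ n x y z _ ih =>
    intro hc σ hσ Γ' Δ' m hm hL hR
    have h0 : ra (σ x) (σ y) (σ z) ∈ Γ' := (covL_cons.1 hL).1
    obtain ⟨Γ'', rfl⟩ := Multiset.exists_cons_of_mem h0
    obtain ⟨k, rfl⟩ : ∃ k, m = k + 1 := ⟨m - 1, by omega⟩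
    refine Deriv.exch _ _ _ ?_
    obtain ⟨gL, gR⟩ := cov_mono hL hR
      (covL_sub fun _ h => Multiset.mem_cons_of_mem (a := _) (b := ra (σ y) (σ x) (σ z)) h)
      (covR_sub fun _ h => h)
    exact ih hc σ hσ _ _ k (by omega) (covL_cons.2 ⟨Multiset.mem_cons_self _ _, gL⟩) gR
  | @assoc c Γ Δ n x y z u v w hw fw _ ih =>
    intro hc σ hσ Γ' Δ' m hm hL hR
    have h0 : ra (σ x) (σ y) (σ z) ∈ Γ' := (covL_cons.1 hL).1
    have h1 : ra (σ u) (σ v) (σ x) ∈ Γ' := (covL_cons.1 (covL_cons.1 hL).2).1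
    obtain ⟨k, rfl⟩ : ∃ k, m = k + 1 := ⟨m - 1, by omega⟩
    obtain ⟨N, hN⟩ := exists_fresh Γ' Δ'
    have fN := hN N le_rfl
    have fz : z ≠ w := by rintro rfl; exact (fresh_cons fw).1 (by simp [ra, labelsOf])
    have fy : y ≠ w := by rintro rfl; exact (fresh_cons fw).1 (by simp [ra, labelsOf])
    have fu : u ≠ w := by
      rintro rfl; exact (fresh_cons (fresh_cons fw).2).1 (by simp [ra, labelsOf])
    have fv : v ≠ w := by
      rintro rfl; exact (fresh_cons (fresh_cons fw).2).1 (by simp [ra, labelsOf])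
    have key : Deriv false (ra (σ u) (.var N) (σ z) ::ₘ ra (σ y) (σ v) (.var N) ::ₘ Γ') Δ' k := by
      obtain ⟨gL, gR⟩ := cov_mono
        (Γ₂ := ra (σ u) (.var N) (σ z) ::ₘ ra (σ y) (σ v) (.var N) ::ₘ Γ') hL hR
        (covL_sub fun _ h => by simp [h]) (covR_sub fun _ h => h)
      refine ih hc (Function.update σ w (.var N)) ?_ _ _ k (by omega) ?_ (covR_upd _ gR fw)
      · rw [Function.update_of_ne hw.symm, hσ]
      · refine covL_cons.2 ⟨?_, covL_cons.2 ⟨?_, covL_upd _ gL fw⟩⟩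
        · simp only [ra, mapE, covE, Function.update_self, Function.update_of_ne fz,
            Function.update_of_ne fu, Multiset.mem_cons, true_or]
        · simp only [ra, mapE, covE, Function.update_self, Function.update_of_ne fy,
            Function.update_of_ne fv, Multiset.mem_cons, true_or, or_true]
    by_cases he : ra (σ x) (σ y) (σ z) = ra (σ u) (σ v) (σ x)
    · simp only [ra, Sum.inl.injEq, Prod.mk.injEq] at he
      obtain ⟨e1, e2, e3⟩ := he
      rw [← e1, ← e2, e3] at key
      rw [e3] at h0
      obtain ⟨Γ'', rfl⟩ := Multiset.exists_cons_of_mem h0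
      exact Deriv.assocC _ _ _ (by simp) fN key
    · obtain ⟨Γ₁, rfl⟩ := Multiset.exists_cons_of_mem h0
      have h1 := (Multiset.mem_cons.1 h1).resolve_left (fun h => he h.symm)
      obtain ⟨Γ'', rfl⟩ := Multiset.exists_cons_of_mem h1
      exact Deriv.assoc _ _ _ _ _ _ (by simp) fN key
  | @unit c Γ Δ n x _ ih =>
    intro hc σ hσ Γ' Δ' m hm hL hR
    obtain ⟨k, rfl⟩ : ∃ k, m = k + 1 := ⟨m - 1, by omega⟩
    refine Deriv.unit (σ x) ?_
    obtain ⟨gL, gR⟩ := cov_mono hL hR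
      (covL_sub fun _ h => Multiset.mem_cons_of_mem (b := ra (σ x) Label.eps (σ x)) h)
      (covR_sub fun _ h => h)
    refine ih hc σ hσ _ _ k (by omega) (covL_cons.2 ⟨?_, gL⟩) gR
    simp [ra, mapE, covE, hσ]
  | @assocC c Γ Δ n x y w hw fw _ ih =>
    intro hc σ hσ Γ' Δ' m hm hL hR
    have h0 : ra (σ x) (σ y) (σ x) ∈ Γ' := (covL_cons.1 hL).1
    obtain ⟨k, rfl⟩ : ∃ k, m = k + 1 := ⟨m - 1, by omega⟩
    obtain ⟨N, hN⟩ := exists_fresh Γ' Δ'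
    have fN := hN N le_rfl
    have fx : x ≠ w := by rintro rfl; exact (fresh_cons fw).1 (by simp [ra, labelsOf])
    have fy : y ≠ w := by rintro rfl; exact (fresh_cons fw).1 (by simp [ra, labelsOf])
    obtain ⟨gL, gR⟩ := cov_mono
      (Γ₂ := ra (σ x) (.var N) (σ x) ::ₘ ra (σ y) (σ y) (.var N) ::ₘ Γ') hL hR
      (covL_sub fun _ h => by simp [h]) (covR_sub fun _ h => h)
    obtain ⟨Γ'', rfl⟩ := Multiset.exists_cons_of_mem h0
    refine Deriv.assocC _ _ (.var N) (by simp) fN ?_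
    refine ih hc (Function.update σ w (.var N)) ?_ _ _ k (by omega) ?_ (covR_upd _ gR fw)
    · rw [Function.update_of_ne hw.symm, hσ]
    · refine covL_cons.2 ⟨?_, covL_cons.2 ⟨?_, covL_upd _ gL fw⟩⟩
      · simp only [ra, mapE, covE, Function.update_self, Function.update_of_ne fx,
          Multiset.mem_cons, true_or]
      · simp only [ra, mapE, covE, Function.update_self, Function.update_of_ne fy,
          Multiset.mem_cons, true_or, or_true]
  | @eq1 c Γ Δ n w w' hw _ ih =>
    intro hc σ hσ Γ' Δ' m hm hL hR
    obtain ⟨h0, hL⟩ := covL_cons.1 hL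
    have h0 : ra (σ Label.eps) (σ w) (σ w') ∈ Γ' := h0
    rw [hσ] at h0
    by_cases hs : σ w = Label.eps
    · by_cases hs' : σ w' = Label.eps
      · refine ih hc σ hσ Γ' Δ' m (by omega) (covL_cons.2 ⟨?_, covL_subst (hs.trans hs'.symm) hL⟩)
          (covR_subst (hs.trans hs'.symm) hR)
        simpa only [ra, mapE, covE, hσ, hs, hs'] using h0
      · obtain ⟨k, rfl⟩ : ∃ k, m = k + 1 := ⟨m - 1, by omega⟩
        rw [hs] at h0
        obtain ⟨Γ'', rfl⟩ := Multiset.exists_cons_of_mem h0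
        refine Deriv.eq2 _ _ hs' ?_
        obtain ⟨gL, gR⟩ := cov_eq (w := w) (w' := w') (a := σ w') (b := Label.eps) hL hR hs'
          (by rw [hs, lsub_target]) (lsub_self _ _)
          (by simp only [ra, substElem, lsub_self, lsub_target]) hσ
        exact ih hc _ (by simp [hσ, lsub_target]) _ _ k (by omega) gL gR
    · obtain ⟨k, rfl⟩ : ∃ k, m = k + 1 := ⟨m - 1, by omega⟩
      obtain ⟨Γ'', rfl⟩ := Multiset.exists_cons_of_mem h0
      refine Deriv.eq1 _ _ hs ?_
      obtain ⟨gL, gR⟩ := cov_eq (w := w) (w' := w') (a := σ w) (b := σ w') hL hR hs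
        (lsub_self _ _) (lsub_target _ _)
        (by simp only [ra, substElem, lsub_self, lsub_target, lsub_eps hs]) hσ
      exact ih hc _ (by simp [hσ, lsub_eps hs]) _ _ k (by omega) gL gR
  | @eq2 c Γ Δ n w w' hw _ ih =>
    intro hc σ hσ Γ' Δ' m hm hL hR
    obtain ⟨h0, hL⟩ := covL_cons.1 hL
    have h0 : ra (σ Label.eps) (σ w') (σ w) ∈ Γ' := h0
    rw [hσ] at h0
    by_cases hs : σ w = Label.eps
    · by_cases hs' : σ w' = Label.eps
      · refine ih hc σ hσ Γ' Δ' m (by omega) (covL_cons.2 ⟨?_, covL_subst (hs.trans hs'.symm) hL⟩)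
          (covR_subst (hs.trans hs'.symm) hR)
        simpa only [ra, mapE, covE, hσ, hs, hs'] using h0
      · obtain ⟨k, rfl⟩ : ∃ k, m = k + 1 := ⟨m - 1, by omega⟩
        rw [hs] at h0
        obtain ⟨Γ'', rfl⟩ := Multiset.exists_cons_of_mem h0
        refine Deriv.eq1 _ _ hs' ?_
        obtain ⟨gL, gR⟩ := cov_eq (w := w) (w' := w') (a := σ w') (b := Label.eps) hL hR hs'
          (by rw [hs, lsub_target]) (lsub_self _ _)
          (by simp only [ra, substElem, lsub_self, lsub_target]) hσ
        exact ih hc _ (by simp [hσ, lsub_target]) _ _ k (by omega) gL gR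
    · obtain ⟨k, rfl⟩ : ∃ k, m = k + 1 := ⟨m - 1, by omega⟩
      obtain ⟨Γ'', rfl⟩ := Multiset.exists_cons_of_mem h0
      refine Deriv.eq2 _ _ hs ?_
      obtain ⟨gL, gR⟩ := cov_eq (w := w) (w' := w') (a := σ w) (b := σ w') hL hR hs
        (lsub_self _ _) (lsub_target _ _)
        (by simp only [ra, substElem, lsub_self, lsub_target, lsub_eps hs]) hσ
      exact ih hc _ (by simp [hσ, lsub_eps hs]) _ _ k (by omega) gL gR
  | cut => intro hc; simp at hc

/-- Contraction and weakening at once: derivability only depends on the underlying sets. -/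
theorem deriv_of_subset {Γ Γ' Δ Δ' n} (h : Deriv false Γ Δ n) (hL : Γ ⊆ Γ') (hR : Δ ⊆ Δ') :
    Deriv false Γ' Δ' n :=
  master h rfl (fun x => x) rfl _ _ n le_rfl (covL_sub hL) (covR_sub hR)

/-- Contraction admissibility for LS_BBI: contracting the whole sequent
preserves derivability with the same height; in particular, contraction on a
relational atom preserves derivability without increasing the height. -/
theorem lsbbi_contraction :
    (∀ (Γ : Multiset LElem) (Δ : Multiset LForm) (n : ℕ),
        Deriv false (Γ + Γ) (Δ + Δ) n → Deriv false Γ Δ n) ∧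
    (∀ (x y z : Label) (Γ : Multiset LElem) (Δ : Multiset LForm) (n : ℕ),
        Deriv false (ra x y z ::ₘ ra x y z ::ₘ Γ) Δ n →
        ∃ m ≤ n, Deriv false (ra x y z ::ₘ Γ) Δ m) := by 
  refine ⟨fun Γ Δ n h => deriv_of_subset h ?_ ?_, fun x y z Γ Δ n h => ⟨n, le_rfl,
    deriv_of_subset h ?_ fun _ h => h⟩⟩
  · intro e he; simpa using he
  · intro e he; simpa using he
  · intro e he; simp only [Multiset.mem_cons] at he ⊢; tauto
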